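/- arXiv:2303.13246 — 3 statements merged into one kernel-verified Lean document; each statement's English description precedes it below -/
import Mathlib

section
/- Let g̃ : S → ℝ be continuously differentiable, let M, L > 0, and let ρᵈ : ℝ≥0 × S → ℝ be continuously differentiable with ‖ρᵈ(t,·)‖₂ ≤ M and ‖ρᵈ_x(t,·)‖₂ ≤ L for all t ≥ 0. Let K_p > 0 and let e : ℝ≥0 × S → ℝ be a continuously differentiable solution (C¹ in t, C² in x) of e_t(t,x) = −K_p e(t,x) + [e(t,·) Ũᵈ(t,·)]_x(x) + [ρᵈ(t,·) Ũᵉ(t,·)]_x(x) − [e(t,·) Ũᵉ(t,·)]_x(x), where Ũᵈ(t,·) = g̃ * ρᵈ(t,·) and Ũᵉ(t,·) = g̃ * e(t,·). Then for every γ > 0, if K_p > (γ/2)‖g̃_x‖₂ + (3M/2)‖g̃_x‖₂ + L‖g̃‖₂ and ‖e(0,·)‖₂ < γ, then ‖e(t,·)‖₂ < γ for all t ≥ 0 and ‖e(t,·)‖₂ → 0 as t → ∞. -/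
open MeasureTheory Real Filter

/-- The `L²`-norm on the circle `S = [-π, π]` (endpoints identified). -/
noncomputable def L2norm (h : ℝ → ℝ) : ℝ :=
  Real.sqrt (∫ x in (-Real.pi)..Real.pi, h x ^ 2)

/-- Circular convolution on `S = [-π, π]`. -/
noncomputable def circConv (f g : ℝ → ℝ) : ℝ → ℝ :=
  fun x => ∫ y in (-Real.pi)..Real.pi, f (x - y) * g y

theorem hasDerivAt_integral_param {F F' : ℝ → ℝ → ℝ} (a b : ℝ)
    (hF : ∀ t, Continuous (F t)) (hF' : Continuous (fun p : ℝ × ℝ => F' p.1 p.2))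
    (hd : ∀ t x, HasDerivAt (fun τ => F τ x) (F' t x) t) (t : ℝ) :
    HasDerivAt (fun τ => ∫ x in a..b, F τ x) (∫ x in a..b, F' t x) t := by
  obtain ⟨C, hC⟩ := ((isCompact_closedBall t 1).prod
    (isCompact_uIcc (a := a) (b := b))).exists_bound_of_continuousOn hF'.continuousOn
  refine (intervalIntegral.hasDerivAt_integral_of_dominated_loc_of_deriv_le
    (F := F) (F' := F') (bound := fun _ => C) (Metric.ball_mem_nhds t one_pos)
    (Eventually.of_forall fun τ => (hF τ).aestronglyMeasurable)
    ((hF t).intervalIntegrable a b)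
    (by fun_prop : Continuous (F' t)).aestronglyMeasurable
    (Eventually.of_forall fun x hx τ hτ => ?_)
    intervalIntegrable_const
    (Eventually.of_forall fun x _ τ _ => hd τ x)).2
  exact hC (τ, x) ⟨Metric.ball_subset_closedBall hτ, Set.uIoc_subset_uIcc hx⟩

theorem L2norm_nonneg (h : ℝ → ℝ) : 0 ≤ L2norm h := Real.sqrt_nonneg _

theorem neg_pi_le_pi : -Real.pi ≤ Real.pi := by linarith [Real.pi_pos]

theorem L2norm_sq (h : ℝ → ℝ) :
    L2norm h ^ 2 = ∫ x in (-Real.pi)..Real.pi, h x ^ 2 :=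
  Real.sq_sqrt (intervalIntegral.integral_nonneg neg_pi_le_pi fun _ _ => sq_nonneg _)

theorem integral_abs_mul_le_L2norm {f g : ℝ → ℝ} (hf : Continuous f) (hg : Continuous g) :
    ∫ x in (-Real.pi)..Real.pi, |f x * g x| ≤ L2norm f * L2norm g := by
  have key : ∀ s : ℝ, 0 ≤ L2norm f ^ 2 * (s * s)
      + (2 * ∫ x in (-Real.pi)..Real.pi, |f x * g x|) * s + L2norm g ^ 2 := by
    intro s
    have h : ∫ x in (-Real.pi)..Real.pi, (|f x| * s + |g x|) ^ 2
        = L2norm f ^ 2 * (s * s)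
          + (2 * ∫ x in (-Real.pi)..Real.pi, |f x * g x|) * s + L2norm g ^ 2 := by
      have e1 : ∀ x, (|f x| * s + |g x|) ^ 2
          = f x ^ 2 * (s * s) + |f x * g x| * (2 * s) + g x ^ 2 := by
        intro x
        rw [abs_mul, ← sq_abs (f x), ← sq_abs (g x)]; ring
      simp_rw [e1]
      rw [intervalIntegral.integral_add (Continuous.intervalIntegrable (by fun_prop) _ _)
          (Continuous.intervalIntegrable (by fun_prop) _ _),
        intervalIntegral.integral_add (Continuous.intervalIntegrable (by fun_prop) _ _)
          (Continuous.intervalIntegrable (by fun_prop) _ _),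
        intervalIntegral.integral_mul_const, intervalIntegral.integral_mul_const,
        L2norm_sq, L2norm_sq]
      ring
    rw [← h]
    exact intervalIntegral.integral_nonneg neg_pi_le_pi fun _ _ => sq_nonneg _
  have hd := discrim_le_zero key
  rw [discrim] at hd
  refine (le_abs_self _).trans (abs_le_of_sq_le_sq ?_
    (mul_nonneg (L2norm_nonneg f) (L2norm_nonneg g)))
  nlinarith

theorem L2norm_comp_const_sub {g : ℝ → ℝ} (hg : Function.Periodic g (2 * Real.pi)) (x : ℝ) :
    L2norm (fun y => g (x - y)) = L2norm g := by
  unfold L2norm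
  rw [intervalIntegral.integral_comp_sub_left (fun y => g y ^ 2) x]
  have hp : Function.Periodic (fun y => g y ^ 2) (2 * Real.pi) := fun y => by simp [hg y]
  have := hp.intervalIntegral_add_eq (x - Real.pi) (-Real.pi)
  rw [show x - Real.pi + 2 * Real.pi = x - -Real.pi by ring,
    show -Real.pi + 2 * Real.pi = Real.pi by ring] at this
  rw [this]

theorem abs_circConv_le {g f : ℝ → ℝ} (hg : Continuous g)
    (hgper : Function.Periodic g (2 * Real.pi)) (hf : Continuous f) (x : ℝ) :
    |circConv g f x| ≤ L2norm g * L2norm f := by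
  rw [← L2norm_comp_const_sub hgper x]
  exact (intervalIntegral.abs_integral_le_integral_abs neg_pi_le_pi).trans
    (integral_abs_mul_le_L2norm (by fun_prop) hf)

theorem periodic_circConv {g : ℝ → ℝ} (hg : Function.Periodic g (2 * Real.pi)) (f : ℝ → ℝ) :
    Function.Periodic (circConv g f) (2 * Real.pi) := by
  intro x
  unfold circConv
  congr 1
  ext y
  rw [show x + 2 * Real.pi - y = x - y + 2 * Real.pi by ring, hg]

theorem periodic_deriv {g : ℝ → ℝ} {c : ℝ} (hg : Function.Periodic g c) :
    Function.Periodic (deriv g) c := by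
  intro x
  rw [← deriv_comp_add_const]
  congr 1
  exact funext hg

theorem hasDerivAt_circConv {g f : ℝ → ℝ} (hg : ContDiff ℝ 1 g) (hf : Continuous f) (x : ℝ) :
    HasDerivAt (circConv g f) (circConv (deriv g) f x) x := by
  have hgc := hg.continuous
  have hg' := hg.continuous_deriv le_rfl
  refine hasDerivAt_integral_param (F := fun x y => g (x - y) * f y)
    (F' := fun x y => deriv g (x - y) * f y) _ _ (fun t => by fun_prop) (by fun_prop)
    (fun t y => ?_) x
  exact (((hg.differentiable (by norm_num) (t - y)).hasDerivAt).comp_sub_const t y).mul_const _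

theorem continuous_circConv {g f : ℝ → ℝ} (hg : Continuous g) (hf : Continuous f) :
    Continuous (circConv g f) := by
  unfold circConv
  exact intervalIntegral.continuous_parametric_intervalIntegral_of_continuous' (by fun_prop) _ _

theorem contDiff_circConv {g f : ℝ → ℝ} (hg : ContDiff ℝ 1 g) (hf : Continuous f) :
    ContDiff ℝ 1 (circConv g f) := by
  rw [contDiff_one_iff_deriv]
  refine ⟨fun x => (hasDerivAt_circConv hg hf x).differentiableAt, ?_⟩
  rw [show deriv (circConv g f) = circConv (deriv g) f from
    funext fun x => (hasDerivAt_circConv hg hf x).deriv]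
  exact continuous_circConv (hg.continuous_deriv le_rfl) hf

theorem abs_deriv_circConv_le {g f : ℝ → ℝ} (hg : ContDiff ℝ 1 g)
    (hgper : Function.Periodic g (2 * Real.pi)) (hf : Continuous f) (x : ℝ) :
    |deriv (circConv g f) x| ≤ L2norm (deriv g) * L2norm f := by
  rw [(hasDerivAt_circConv hg hf x).deriv]
  exact abs_circConv_le (hg.continuous_deriv le_rfl) (periodic_deriv hgper) hf x

theorem deriv_mul_eq {u U : ℝ → ℝ} (hu : ContDiff ℝ 1 u) (hU : ContDiff ℝ 1 U) (x : ℝ) :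
    deriv (fun y => u y * U y) x = deriv u x * U x + u x * deriv U x :=
  ((hu.differentiable (by norm_num) x).hasDerivAt.mul
    (hU.differentiable (by norm_num) x).hasDerivAt).deriv

theorem abs_integral_mul_deriv_self_mul_le {u U : ℝ → ℝ} {K : ℝ}
    (hu : ContDiff ℝ 1 u) (hU : ContDiff ℝ 1 U)
    (huper : Function.Periodic u (2 * Real.pi)) (hUper : Function.Periodic U (2 * Real.pi))
    (hK : ∀ x, |deriv U x| ≤ K) :
    |∫ x in (-Real.pi)..Real.pi, u x * deriv (fun y => u y * U y) x|
      ≤ K / 2 * L2norm u ^ 2 := by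
  have hu' := hu.continuous_deriv le_rfl
  have hU' := hU.continuous_deriv le_rfl
  have huc := hu.continuous
  have hUc := hU.continuous
  have h0 : ∫ x in (-Real.pi)..Real.pi,
      (u x * deriv u x * U x + u x ^ 2 / 2 * deriv U x) = 0 := by
    rw [intervalIntegral.integral_eq_sub_of_hasDerivAt (f := fun x => u x ^ 2 / 2 * U x)]
    · have e1 := huper (-Real.pi)
      have e2 := hUper (-Real.pi)
      rw [show -Real.pi + 2 * Real.pi = Real.pi by ring] at e1 e2
      simp [e1, e2]
    · intro x _
      have d1 := (hu.differentiable (by norm_num) x).hasDerivAt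
      have d2 := (hU.differentiable (by norm_num) x).hasDerivAt
      refine (((d1.fun_pow 2).div_const 2).fun_mul d2).congr_deriv ?_
      simp only [Nat.cast_ofNat, Nat.add_one_sub_one, pow_one]
      ring
    · exact Continuous.intervalIntegrable (by fun_prop) _ _
  have h1 : ∫ x in (-Real.pi)..Real.pi, u x * deriv (fun y => u y * U y) x
      = ∫ x in (-Real.pi)..Real.pi, u x ^ 2 / 2 * deriv U x := by
    have e1 : ∀ x, u x * deriv (fun y => u y * U y) x
        = (u x * deriv u x * U x + u x ^ 2 / 2 * deriv U x) + u x ^ 2 / 2 * deriv U x := by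
      intro x; rw [deriv_mul_eq hu hU]; ring
    simp_rw [e1]
    rw [intervalIntegral.integral_add (Continuous.intervalIntegrable (by fun_prop) _ _)
      (Continuous.intervalIntegrable (by fun_prop) _ _), h0, zero_add]
  rw [h1, L2norm_sq, ← intervalIntegral.integral_const_mul]
  refine (intervalIntegral.abs_integral_le_integral_abs neg_pi_le_pi).trans ?_
  refine intervalIntegral.integral_mono_on neg_pi_le_pi
    (Continuous.intervalIntegrable (by fun_prop) _ _)
    (Continuous.intervalIntegrable (by fun_prop) _ _) fun x _ => ?_
  rw [abs_mul, abs_of_nonneg (by positivity)]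
  nlinarith [mul_le_mul_of_nonneg_left (hK x) (sq_nonneg (u x))]

theorem abs_integral_mul_deriv_mul_le {u r V : ℝ → ℝ} {A B : ℝ}
    (hu : Continuous u) (hr : ContDiff ℝ 1 r) (hV : ContDiff ℝ 1 V)
    (hA : ∀ x, |V x| ≤ A) (hB : ∀ x, |deriv V x| ≤ B) :
    |∫ x in (-Real.pi)..Real.pi, u x * deriv (fun y => r y * V y) x|
      ≤ L2norm u * (L2norm (deriv r) * A + L2norm r * B) := by
  have hr' := hr.continuous_deriv le_rfl
  have hV' := hV.continuous_deriv le_rfl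
  have hrc := hr.continuous
  have hVc := hV.continuous
  have hA0 : 0 ≤ A := (abs_nonneg _).trans (hA 0)
  have hB0 : 0 ≤ B := (abs_nonneg _).trans (hB 0)
  simp_rw [deriv_mul_eq hr hV]
  calc _ ≤ ∫ x in (-Real.pi)..Real.pi, |u x * (deriv r x * V x + r x * deriv V x)| :=
        intervalIntegral.abs_integral_le_integral_abs neg_pi_le_pi
    _ ≤ ∫ x in (-Real.pi)..Real.pi, (A * |u x * deriv r x| + B * |u x * r x|) := by
        refine intervalIntegral.integral_mono_on neg_pi_le_pi
          (Continuous.intervalIntegrable (by fun_prop) _ _)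
          (Continuous.intervalIntegrable (by fun_prop) _ _) fun x _ => ?_
        rw [show u x * (deriv r x * V x + r x * deriv V x)
          = V x * (u x * deriv r x) + deriv V x * (u x * r x) by ring]
        refine (abs_add_le _ _).trans ?_
        rw [abs_mul (V x), abs_mul (deriv V x)]
        gcongr
        · exact hA x
        · exact hB x
    _ = A * (∫ x in (-Real.pi)..Real.pi, |u x * deriv r x|)
        + B * ∫ x in (-Real.pi)..Real.pi, |u x * r x| := by
        rw [intervalIntegral.integral_add (Continuous.intervalIntegrable (by fun_prop) _ _)
          (Continuous.intervalIntegrable (by fun_prop) _ _),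
          intervalIntegral.integral_const_mul, intervalIntegral.integral_const_mul]
    _ ≤ A * (L2norm u * L2norm (deriv r)) + B * (L2norm u * L2norm r) := by
        gcongr
        · exact integral_abs_mul_le_L2norm hu hr'
        · exact integral_abs_mul_le_L2norm hu hrc
    _ = _ := by ring

/-- The `L²` energy estimate for the right-hand side of the error dynamics. -/
theorem integral_mul_dynamics_le {g u r : ℝ → ℝ} (hg : ContDiff ℝ 1 g)
    (hgper : Function.Periodic g (2 * Real.pi)) (hu : ContDiff ℝ 1 u)
    (huper : Function.Periodic u (2 * Real.pi)) (hr : ContDiff ℝ 1 r) (k : ℝ) :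
    ∫ x in (-Real.pi)..Real.pi, u x * (-k * u x
        + deriv (fun y => u y * circConv g r y) x
        + deriv (fun y => r y * circConv g u y) x
        - deriv (fun y => u y * circConv g u y) x)
      ≤ -(k - 3 / 2 * (L2norm (deriv g) * L2norm r) - L2norm g * L2norm (deriv r)
          - 1 / 2 * (L2norm (deriv g) * L2norm u)) * L2norm u ^ 2 := by
  have hU := contDiff_circConv hg hr.continuous
  have hV := contDiff_circConv hg hu.continuous
  have huc := hu.continuous
  have c1 := (hu.mul hU).continuous_deriv le_rfl
  have c2 := (hr.mul hV).continuous_deriv le_rfl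
  have c3 := (hu.mul hV).continuous_deriv le_rfl
  have b1 := abs_integral_mul_deriv_self_mul_le hu hU huper (periodic_circConv hgper r)
    (abs_deriv_circConv_le hg hgper hr.continuous)
  have b2 := abs_integral_mul_deriv_mul_le huc hr hV
    (abs_circConv_le hg.continuous hgper huc) (abs_deriv_circConv_le hg hgper huc)
  have b3 := abs_integral_mul_deriv_self_mul_le hu hV huper (periodic_circConv hgper u)
    (abs_deriv_circConv_le hg hgper huc)
  simp_rw [mul_sub, mul_add, show ∀ x, u x * (-k * u x) = -k * u x ^ 2 from fun x => by ring]
  rw [intervalIntegral.integral_sub (Continuous.intervalIntegrable (by fun_prop) _ _)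
      (Continuous.intervalIntegrable (by fun_prop) _ _),
    intervalIntegral.integral_add (Continuous.intervalIntegrable (by fun_prop) _ _)
      (Continuous.intervalIntegrable (by fun_prop) _ _),
    intervalIntegral.integral_add (Continuous.intervalIntegrable (by fun_prop) _ _)
      (Continuous.intervalIntegrable (by fun_prop) _ _),
    intervalIntegral.integral_const_mul, ← L2norm_sq]
  have b1' := (le_abs_self _).trans b1
  have b2' := (le_abs_self _).trans b2
  have b3' := (neg_le_abs _).trans b3
  linarith

theorem hasDerivAt_L2norm_sq {e : ℝ → ℝ → ℝ}
    (he : ContDiff ℝ 1 (fun p : ℝ × ℝ => e p.1 p.2)) (t : ℝ) :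
    HasDerivAt (fun τ => L2norm (e τ) ^ 2)
      (2 * ∫ x in (-Real.pi)..Real.pi, e t x * deriv (fun τ => e τ x) t) t := by
  have hec := he.continuous
  have hpart : ∀ t x, HasDerivAt (fun τ => e τ x)
      (fderiv ℝ (fun p : ℝ × ℝ => e p.1 p.2) (t, x) (1, 0)) t := by
    intro t x
    have h1 := (he.differentiable (by norm_num) (t, x)).hasFDerivAt
    exact h1.comp_hasDerivAt t ((hasDerivAt_id t).prodMk (hasDerivAt_const t x))
  have hcont : Continuous fun p : ℝ × ℝ =>
      fderiv ℝ (fun p : ℝ × ℝ => e p.1 p.2) p (1, 0) :=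
    (he.continuous_fderiv (by norm_num)).clm_apply continuous_const
  have hd : ∀ t x, HasDerivAt (fun τ => e τ x ^ 2)
      (2 * (e t x * deriv (fun τ => e τ x) t)) t := by
    intro t x
    refine ((hpart t x).fun_pow 2).congr_deriv ?_
    rw [(hpart t x).deriv]
    norm_num
    ring
  simp_rw [L2norm_sq]
  rw [← intervalIntegral.integral_const_mul]
  refine hasDerivAt_integral_param (F := fun t x => e t x ^ 2)
    (F' := fun t x => 2 * (e t x * deriv (fun τ => e τ x) t)) _ _
    (fun t => (hec.comp (by fun_prop : Continuous fun x : ℝ => (t, x))).pow 2) ?_ hd t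
  simp_rw [(hpart _ _).deriv]
  exact continuous_const.mul (hec.mul hcont)

/-- A Grönwall-type trapping lemma: if `W` decays at rate `a` whenever it lies below the threshold
`b`, and it starts below `b`, then it decays exponentially forever. -/
theorem le_mul_exp_of_deriv_le_of_le {W W' : ℝ → ℝ} {a b : ℝ} (ha : 0 < a) (hb : 0 < b)
    (hW : ∀ t, HasDerivAt W (W' t) t)
    (hW' : ∀ t, 0 ≤ t → W t ≤ b → W' t ≤ -a * W t) (h0 : W 0 ≤ b) {t : ℝ} (ht : 0 ≤ t) :
    W t ≤ W 0 * Real.exp (-a * t) := by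
  have hc : Continuous W := continuous_iff_continuousAt.2 fun t => (hW t).continuousAt
  have htrap : ∀ s, 0 ≤ s → W s ≤ b := by
    intro s hs
    refine image_le_of_deriv_right_lt_deriv_boundary (f := W) (f' := W') (a := 0) (b := s)
      (B := fun _ => b) (B' := fun _ => 0) hc.continuousOn
      (fun x _ => (hW x).hasDerivWithinAt) h0 (fun x => hasDerivAt_const x b) ?_ ⟨hs, le_rfl⟩
    intro x hx hxb
    have := hW' x hx.1 hxb.le
    rw [hxb] at this
    nlinarith [mul_pos ha hb]
  have hd : ∀ s, HasDerivAt (fun s => W s * Real.exp (a * s))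
      (W' s * Real.exp (a * s) + W s * (Real.exp (a * s) * (a * 1))) s := fun s =>
    (hW s).mul (((hasDerivAt_id s).const_mul a).exp)
  have hanti : AntitoneOn (fun s => W s * Real.exp (a * s)) (Set.Ici 0) := by
    refine antitoneOn_of_deriv_nonpos (convex_Ici 0) (by fun_prop)
      (fun s _ => (hd s).differentiableAt.differentiableWithinAt) fun s hs => ?_
    rw [interior_Ici, Set.mem_Ioi] at hs
    rw [(hd s).deriv]
    nlinarith [hW' s hs.le (htrap s hs.le), Real.exp_pos (a * s)]
  have h := hanti (Set.mem_Ici.2 le_rfl) (Set.mem_Ici.2 ht) ht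
  simp only [mul_zero, Real.exp_zero, mul_one] at h
  rw [neg_mul, Real.exp_neg, ← div_eq_mul_inv, le_div_iff₀ (Real.exp_pos _)]
  exact h

/-- **Theorem 3 (LAS with kernel perturbation).**
With kernel mismatch `gTilde`, if `K_p > (γ/2)‖gTilde_x‖₂ + (3M/2)‖gTilde_x‖₂ + L‖gTilde‖₂` and
`‖e(0,·)‖₂ < γ`, then the error stays below `γ` and tends to `0`. -/
theorem kernel_perturbation_LAS
    (gTilde : ℝ → ℝ) (hgTilde : ContDiff ℝ 1 gTilde) (hgTildeper : Function.Periodic gTilde (2 * Real.pi))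
    (M L : ℝ) (hM : 0 < M) (hL : 0 < L)
    (ρd : ℝ → ℝ → ℝ)
    (hρd : ContDiff ℝ 1 (fun p : ℝ × ℝ => ρd p.1 p.2))
    (hρdper : ∀ t, Function.Periodic (ρd t) (2 * Real.pi))
    (hρdM : ∀ t, 0 ≤ t → L2norm (ρd t) ≤ M)
    (hρdL : ∀ t, 0 ≤ t → L2norm (fun x => deriv (ρd t) x) ≤ L)
    (Kp : ℝ) (hKp : 0 < Kp)
    (e : ℝ → ℝ → ℝ)
    (he1 : ContDiff ℝ 1 (fun p : ℝ × ℝ => e p.1 p.2))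
    (he2 : ∀ t, ContDiff ℝ 2 (e t))
    (heper : ∀ t, Function.Periodic (e t) (2 * Real.pi))
    (hdyn : ∀ t, 0 ≤ t → ∀ x : ℝ,
      HasDerivAt (fun τ => e τ x)
        (-Kp * e t x
          + deriv (fun y => e t y * circConv gTilde (ρd t) y) x
          + deriv (fun y => ρd t y * circConv gTilde (e t) y) x
          - deriv (fun y => e t y * circConv gTilde (e t) y) x) t)
    (γ : ℝ) (hγ : 0 < γ)
    (hKpbig : Kp > (γ / 2) * L2norm (fun x => deriv gTilde x)
        + (3 * M / 2) * L2norm (fun x => deriv gTilde x) + L * L2norm gTilde)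
    (h0 : L2norm (e 0) < γ) :
    (∀ t, 0 ≤ t → L2norm (e t) < γ) ∧
      Tendsto (fun t => L2norm (e t)) atTop (nhds 0) := by
  set G := L2norm (fun x => deriv gTilde x) with hG
  set N := L2norm gTilde with hN
  have hG0 : 0 ≤ G := L2norm_nonneg _
  have hN0 : 0 ≤ N := L2norm_nonneg _
  set c := Kp - (γ / 2 * G + 3 * M / 2 * G + L * N) with hc
  have hc0 : 0 < c := by linarith
  have henergy : ∀ t, 0 ≤ t → L2norm (e t) ^ 2 ≤ γ ^ 2 →
      2 * ∫ x in (-Real.pi)..Real.pi, e t x * deriv (fun τ => e τ x) t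
        ≤ -(2 * c) * L2norm (e t) ^ 2 := by
    intro t ht hle
    have hrt : ContDiff ℝ 1 (ρd t) := hρd.comp (contDiff_const.prodMk contDiff_id)
    have hest := integral_mul_dynamics_le hgTilde hgTildeper ((he2 t).of_le (by norm_num))
      (heper t) hrt Kp
    simp_rw [(hdyn t ht _).deriv]
    have hle' : L2norm (e t) ≤ γ := (le_abs_self _).trans (abs_le_of_sq_le_sq hle hγ.le)
    have h1 : G * L2norm (ρd t) ≤ G * M := mul_le_mul_of_nonneg_left (hρdM t ht) hG0
    have h2 : N * L2norm (deriv (ρd t)) ≤ N * L := mul_le_mul_of_nonneg_left (hρdL t ht) hN0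
    have h3 : G * L2norm (e t) ≤ G * γ := mul_le_mul_of_nonneg_left hle' hG0
    have h4 : c ≤ Kp - 3 / 2 * (G * L2norm (ρd t)) - N * L2norm (deriv (ρd t))
        - 1 / 2 * (G * L2norm (e t)) := by linarith
    have h5 := mul_le_mul_of_nonneg_right h4 (sq_nonneg (L2norm (e t)))
    linarith
  have h0sq : L2norm (e 0) ^ 2 < γ ^ 2 := pow_lt_pow_left₀ h0 (L2norm_nonneg _) two_ne_zero
  have hdecay : ∀ t, 0 ≤ t →
      L2norm (e t) ^ 2 ≤ L2norm (e 0) ^ 2 * Real.exp (-(2 * c) * t) := fun t ht =>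
    le_mul_exp_of_deriv_le_of_le (by linarith) (by positivity) (hasDerivAt_L2norm_sq he1)
      henergy h0sq.le ht
  refine ⟨fun t ht => lt_of_pow_lt_pow_left₀ 2 hγ.le (lt_of_le_of_lt ?_ h0sq), ?_⟩
  · refine (hdecay t ht).trans (mul_le_of_le_one_right (sq_nonneg _) (Real.exp_le_one_iff.2 ?_))
    nlinarith
  · have hlin : Tendsto (fun t : ℝ => -(2 * c) * t) atTop atBot :=
      tendsto_id.const_mul_atTop_of_neg (by linarith)
    have hexp := (Real.tendsto_exp_atBot.comp hlin).const_mul (L2norm (e 0) ^ 2)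
    rw [mul_zero] at hexp
    have hsq : Tendsto (fun t => L2norm (e t) ^ 2) atTop (nhds 0) :=
      squeeze_zero' (Eventually.of_forall fun t => sq_nonneg _)
        ((eventually_ge_atTop 0).mono hdecay) hexp
    have := hsq.sqrt
    simpa only [Real.sqrt_zero, Real.sqrt_sq (L2norm_nonneg _)] using this
end

section
/- Let f : S → ℝ be continuously differentiable, let d : ℝ≥0 × S → ℝ be continuously differentiable in x, let ρ, ρᵈ : ℝ≥0 × S → ℝ be continuously differentiable (C¹ in t, C² in x), and define e = ρᵈ − ρ. Suppose ρᵈ satisfies the reference dynamics ρᵈ_t + [ρᵈ (f*ρᵈ)]_x = 0 and ρ satisfies the disturbed controlled dynamics ρ_t + [ρ ((f*ρ) + d)]_x = q with q = K_p e − [e (f*ρᵈ)]_x − [ρ (f*e)]_x, where convolutions are taken in the spatial variable at each time t. Then e satisfies e_t = −K_p e + [(ρᵈ − e) d]_x. -/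
open MeasureTheory Real Filter

/-- The circular convolution of a continuous kernel is additive in its second argument. -/
theorem circConv_sub {f g h : ℝ → ℝ} (hf : Continuous f) (hg : Continuous g) (hh : Continuous h)
    (x : ℝ) : circConv f (fun z => g z - h z) x = circConv f g x - circConv f h x := by
  simp only [circConv, mul_sub]
  exact intervalIntegral.integral_sub (Continuous.intervalIntegrable (by fun_prop) _ _)
    (Continuous.intervalIntegrable (by fun_prop) _ _)

/-- Convolving a continuous function with a `C¹` kernel gives a differentiable function. -/
theorem differentiable_circConv {f g : ℝ → ℝ} (hf : ContDiff ℝ 1 f) (hg : Continuous g) :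
    Differentiable ℝ (circConv f g) := by
  intro x
  have hfc : Continuous f := hf.continuous
  have hf' : Continuous (deriv f) := hf.continuous_deriv le_rfl
  obtain ⟨C, hC⟩ := ((isCompact_closedBall x 1).prod
    (isCompact_uIcc (a := -Real.pi) (b := Real.pi))).exists_bound_of_continuousOn
    (f := fun p : ℝ × ℝ => deriv f (p.1 - p.2) * g p.2) (by fun_prop)
  refine (intervalIntegral.hasDerivAt_integral_of_dominated_loc_of_deriv_le
    (F := fun x y => f (x - y) * g y) (F' := fun x y => deriv f (x - y) * g y)
    (bound := fun _ => C) (Metric.closedBall_mem_nhds x one_pos)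
    (.of_forall fun z => Continuous.aestronglyMeasurable (by fun_prop))
    (Continuous.intervalIntegrable (by fun_prop) _ _)
    (Continuous.aestronglyMeasurable (by fun_prop))
    (.of_forall fun y hy z hz => hC (z, y) ⟨hz, Set.uIoc_subset_uIcc hy⟩)
    intervalIntegrable_const
    (.of_forall fun y _ z _ => ?_)).2.differentiableAt
  exact ((hf.differentiable one_ne_zero (z - y)).hasDerivAt.comp_sub_const z y).mul_const (g y)

/-- **Error dynamics under a velocity-field disturbance (eq. (22) of the paper).**
If `ρᵈ` satisfies the reference dynamics and `ρ` the disturbed controlled dynamics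
with control `q = K_p e − [e (f*ρᵈ)]_x − [ρ (f*e)]_x`, then `e = ρᵈ − ρ` satisfies
`e_t = −K_p e + [(ρᵈ − e) d]_x`. -/
theorem error_dynamics_velocity_disturbance
    (f : ℝ → ℝ) (hf : ContDiff ℝ 1 f)
    (hfper : Function.Periodic f (2 * Real.pi))
    (d : ℝ → ℝ → ℝ)
    (hd : ∀ t, ContDiff ℝ 1 (d t))
    (hdper : ∀ t, Function.Periodic (d t) (2 * Real.pi))
    (Kp : ℝ)
    (ρ ρd : ℝ → ℝ → ℝ)
    (hρ1 : ContDiff ℝ 1 (fun p : ℝ × ℝ => ρ p.1 p.2))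
    (hρ2 : ∀ t, ContDiff ℝ 2 (ρ t))
    (hρper : ∀ t, Function.Periodic (ρ t) (2 * Real.pi))
    (hρd1 : ContDiff ℝ 1 (fun p : ℝ × ℝ => ρd p.1 p.2))
    (hρd2 : ∀ t, ContDiff ℝ 2 (ρd t))
    (hρdper : ∀ t, Function.Periodic (ρd t) (2 * Real.pi))
    (href : ∀ t, 0 ≤ t → ∀ x : ℝ,
      HasDerivAt (fun τ => ρd τ x)
        (-(deriv (fun y => ρd t y * circConv f (ρd t) y) x)) t)
    (hctrl : ∀ t, 0 ≤ t → ∀ x : ℝ,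
      HasDerivAt (fun τ => ρ τ x)
        ((Kp * (ρd t x - ρ t x)
            - deriv (fun y => (ρd t y - ρ t y) * circConv f (ρd t) y) x
            - deriv (fun y => ρ t y * circConv f (fun z => ρd t z - ρ t z) y) x)
          - deriv (fun y => ρ t y * (circConv f (ρ t) y + d t y)) x) t) :
    ∀ t, 0 ≤ t → ∀ x : ℝ,
      HasDerivAt (fun τ => ρd τ x - ρ τ x)
        (-Kp * (ρd t x - ρ t x)
          + deriv (fun y => (ρd t y - (ρd t y - ρ t y)) * d t y) x) t := by
  intro t ht x
  have hρ := hρ2 t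
  have hρd := hρd2 t
  have hρD : Differentiable ℝ (ρ t) := hρ.differentiable two_ne_zero
  have hρdD : Differentiable ℝ (ρd t) := hρd.differentiable two_ne_zero
  have hdD : Differentiable ℝ (d t) := (hd t).differentiable one_ne_zero
  have hU : Differentiable ℝ (circConv f (ρ t)) := differentiable_circConv hf hρ.continuous
  have hV : Differentiable ℝ (circConv f (ρd t)) := differentiable_circConv hf hρd.continuous
  have hW : circConv f (fun z => ρd t z - ρ t z)
      = fun y => circConv f (ρd t) y - circConv f (ρ t) y :=
    funext (circConv_sub hf.continuous hρd.continuous hρ.continuous)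
  have r := (hρD x).hasDerivAt
  have rd := (hρdD x).hasDerivAt
  have δ := (hdD x).hasDerivAt
  have u := (hU x).hasDerivAt
  have v := (hV x).hasDerivAt
  have h₁ := href t ht x
  have h₂ := hctrl t ht x
  rw [hW, (r.fun_mul (u.fun_add δ)).deriv, ((rd.fun_sub r).fun_mul v).deriv,
    (r.fun_mul (v.fun_sub u)).deriv] at h₂
  rw [(rd.fun_mul v).deriv] at h₁
  rw [((rd.fun_sub (rd.fun_sub r)).fun_mul δ).deriv]
  exact (h₁.fun_sub h₂).congr_deriv (by ring)
end

section
/- Let f, f̃ : S → ℝ be continuously differentiable kernels and set g̃ = f̃ − f. Let ρ, ρᵈ : ℝ≥0 × S → ℝ be continuously differentiable (C¹ in t, C² in x) and define e = ρᵈ − ρ. Suppose ρᵈ satisfies the reference dynamics ρᵈ_t + [ρᵈ (f*ρᵈ)]_x = 0 and ρ satisfies ρ_t + [ρ (f*ρ)]_x = q̃ with q̃ = K_p e − [e (f̃*ρᵈ)]_x − [ρ (f̃*e)]_x, where convolutions are taken in the spatial variable at each time t. Then e satisfies e_t = −K_p e + [e (g̃*ρᵈ)]_x + [ρᵈ (g̃*e)]_x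 − [e (g̃*e)]_x. -/
open MeasureTheory Real Filter

theorem intervalIntegrable_circConv_integrand {f g : ℝ → ℝ} (hf : Continuous f)
    (hg : Continuous g) (x : ℝ) :
    IntervalIntegrable (fun y => f (x - y) * g y) volume (-Real.pi) Real.pi :=
  (by fun_prop : Continuous fun y => f (x - y) * g y).intervalIntegrable _ _

theorem circConv_sub_left {f₁ f₂ g : ℝ → ℝ} (hf₁ : Continuous f₁) (hf₂ : Continuous f₂)
    (hg : Continuous g) (x : ℝ) :
    circConv (fun z => f₁ z - f₂ z) g x = circConv f₁ g x - circConv f₂ g x := by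
  simp only [circConv, sub_mul]
  exact intervalIntegral.integral_sub (intervalIntegrable_circConv_integrand hf₁ hg x)
    (intervalIntegrable_circConv_integrand hf₂ hg x)

theorem circConv_sub_right {f g₁ g₂ : ℝ → ℝ} (hf : Continuous f) (hg₁ : Continuous g₁)
    (hg₂ : Continuous g₂) (x : ℝ) :
    circConv f (fun z => g₁ z - g₂ z) x = circConv f g₁ x - circConv f g₂ x := by
  simp only [circConv, mul_sub]
  exact intervalIntegral.integral_sub (intervalIntegrable_circConv_integrand hf hg₁ x)
    (intervalIntegrable_circConv_integrand hf hg₂ x)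

/-- **Error dynamics with a perturbed interaction kernel (eq. (30) of the paper).**
If `ρᵈ` satisfies the reference dynamics and `ρ` the controlled dynamics with the
control computed from the perturbed kernel `f̃`, then `e = ρᵈ − ρ` satisfies
`e_t = −K_p e + [e (g̃*ρᵈ)]_x + [ρᵈ (g̃*e)]_x − [e (g̃*e)]_x`, where `g̃ = f̃ − f`. -/
theorem error_dynamics_kernel_perturbation
    (f fTilde : ℝ → ℝ) (hf : ContDiff ℝ 1 f) (hfTilde : ContDiff ℝ 1 fTilde)
    (hfper : Function.Periodic f (2 * Real.pi))
    (hfTildeper : Function.Periodic fTilde (2 * Real.pi))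
    (Kp : ℝ)
    (ρ ρd : ℝ → ℝ → ℝ)
    (hρ1 : ContDiff ℝ 1 (fun p : ℝ × ℝ => ρ p.1 p.2))
    (hρ2 : ∀ t, ContDiff ℝ 2 (ρ t))
    (hρper : ∀ t, Function.Periodic (ρ t) (2 * Real.pi))
    (hρd1 : ContDiff ℝ 1 (fun p : ℝ × ℝ => ρd p.1 p.2))
    (hρd2 : ∀ t, ContDiff ℝ 2 (ρd t))
    (hρdper : ∀ t, Function.Periodic (ρd t) (2 * Real.pi))
    (href : ∀ t, 0 ≤ t → ∀ x : ℝ,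
      HasDerivAt (fun τ => ρd τ x)
        (-(deriv (fun y => ρd t y * circConv f (ρd t) y) x)) t)
    (hctrl : ∀ t, 0 ≤ t → ∀ x : ℝ,
      HasDerivAt (fun τ => ρ τ x)
        ((Kp * (ρd t x - ρ t x)
            - deriv (fun y => (ρd t y - ρ t y) * circConv fTilde (ρd t) y) x
            - deriv (fun y => ρ t y * circConv fTilde (fun z => ρd t z - ρ t z) y) x)
          - deriv (fun y => ρ t y * circConv f (ρ t) y) x) t) :
    ∀ t, 0 ≤ t → ∀ x : ℝ,
      HasDerivAt (fun τ => ρd τ x - ρ τ x)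
        (-Kp * (ρd t x - ρ t x)
          + deriv (fun y => (ρd t y - ρ t y) *
              circConv (fun z => fTilde z - f z) (ρd t) y) x
          + deriv (fun y => ρd t y *
              circConv (fun z => fTilde z - f z) (fun z => ρd t z - ρ t z) y) x
          - deriv (fun y => (ρd t y - ρ t y) *
              circConv (fun z => fTilde z - f z) (fun z => ρd t z - ρ t z) y) x) t := by
  intro t ht x
  have hfc := hf.continuous
  have hfTc := hfTilde.continuous
  have hρc := (hρ2 t).continuous
  have hρdc := (hρd2 t).continuous
  have hec : Continuous fun z => ρd t z - ρ t z := hρdc.sub hρc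
  have hρD : DifferentiableAt ℝ (ρ t) x := (hρ2 t).differentiable two_ne_zero x
  have hρdD : DifferentiableAt ℝ (ρd t) x := (hρd2 t).differentiable two_ne_zero x
  have h₁ := differentiable_circConv hf hρc x
  have h₂ := differentiable_circConv hf hρdc x
  have h₃ := differentiable_circConv hfTilde hρc x
  have h₄ := differentiable_circConv hfTilde hρdc x
  have href' := href t ht x
  have hctrl' := hctrl t ht x
  simp only [circConv_sub_right hfTc hρdc hρc] at hctrl'
  simp only [circConv_sub_left hfTc hfc hρdc, circConv_sub_left hfTc hfc hec,
    circConv_sub_right hfTc hρdc hρc, circConv_sub_right hfc hρdc hρc]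
  refine (href'.sub hctrl').congr_deriv ?_
  simp (disch := fun_prop) only [deriv_fun_mul, deriv_fun_sub]
  ring
end
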